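/- Promotion on rectangular semistandard Young tableaux has order dividing n: if T is a semistandard Young tableau of rectangular shape with k rows and d columns with entries in {1,...,n}, then applying the promotion operator n times to T returns T. -/

import Mathlib

/-- `T` is a semistandard Young tableau of rectangular shape with `k` rows and `d`
columns, with entries in `{1,…,n}`: rows weakly increase, columns strictly increase.
(The values of `T` outside the rectangle are irrelevant.) -/
def IsSSYT (k d n : ℕ) (T : ℕ → ℕ → ℕ) : Prop :=
  (∀ r c, r < k → c < d → 1 ≤ T r c ∧ T r c ≤ n) ∧
  (∀ r c, r < k → c + 1 < d → T r c ≤ T r (c + 1)) ∧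
  (∀ r c, r + 1 < k → c < d → T r c < T (r + 1) c)

/-- A cell `(r,c)` of a tableau with `k` rows is *free* for the Bender–Knuth toggle `t_i`:
an entry `i` is free if the cell directly below does not contain `i+1`, and an entry
`i+1` is free if the cell directly above does not contain `i`. -/
def bkFree (k i : ℕ) (T : ℕ → ℕ → ℕ) (r c : ℕ) : Prop :=
  (T r c = i ∧ (r + 1 = k ∨ T (r + 1) c ≠ i + 1)) ∨
  (T r c = i + 1 ∧ (r = 0 ∨ T (r - 1) c ≠ i))

open Classical in
/-- The Bender–Knuth involution `t_i` on (the rectangle `k × d` of) a tableau: in each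
row, if the free entries consist of `a` letters `i` followed by `b` letters `i+1`,
replace them by `b` letters `i` followed by `a` letters `i+1`. -/
noncomputable def bk (k d i : ℕ) (T : ℕ → ℕ → ℕ) : ℕ → ℕ → ℕ := fun r c =>
  let F := (Finset.range d).filter fun c' => bkFree k i T r c'
  if c ∈ F then
    if (F.filter fun c' => c' < c).card < (F.filter fun c' => T r c' = i + 1).card
    then i else i + 1
  else T r c

/-- Promotion `χ` on semistandard tableaux with entries in `{1,…,n}`, computed as the
composite of Bender–Knuth involutions `t_1 ∘ t_2 ∘ ⋯ ∘ t_{n-1}`.  This is the standard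
equivalent description of jeu-de-taquin promotion (delete the `n`'s, slide the remaining
entries to the bottom right, add one to every entry, fill the vacated boxes with `1`'s). -/
noncomputable def promo (k d n : ℕ) (T : ℕ → ℕ → ℕ) : ℕ → ℕ → ℕ :=
  (((List.range (n - 1)).map (· + 1)).foldr (fun i acc => bk k d i acc) T)

section Wedge

open ExteriorAlgebra

/-- The linear form on the exterior algebra of `ℝ^k` that is the determinant in degree `k` and
vanishes in all other degrees. -/
noncomputable def topForm (k : ℕ) : ExteriorAlgebra ℝ (Fin k → ℝ) →ₗ[ℝ] ℝ :=
  liftAlternating (Pi.single k Matrix.detRowAlternating)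

lemma topForm_ofFn (k : ℕ) (v : Fin k → Fin k → ℝ) :
    topForm k (List.ofFn fun i => ι ℝ (v i)).prod = Matrix.det (Matrix.of v) := by
  rw [← ιMulti_apply, topForm, liftAlternating_apply_ιMulti, Pi.single_eq_same]
  rfl

lemma topForm_three_term {k : ℕ} (w : List (Fin k → ℝ)) (hw : w.length + 2 = k)
    (a b c d : Fin k → ℝ) :
    topForm k (ι ℝ a * ι ℝ b * (w.map (ι ℝ)).prod) * topForm k (ι ℝ c * ι ℝ d * (w.map (ι ℝ)).prod)
      = topForm k (ι ℝ a * ι ℝ c * (w.map (ι ℝ)).prod) *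
          topForm k (ι ℝ b * ι ℝ d * (w.map (ι ℝ)).prod)
        - topForm k (ι ℝ b * ι ℝ c * (w.map (ι ℝ)).prod) *
          topForm k (ι ℝ a * ι ℝ d * (w.map (ι ℝ)).prod) := by
  obtain ⟨K, hK⟩ : ∃ K, K = w.length := ⟨_, rfl⟩
  rw [← hK] at hw
  subst hw
  have key : ∀ x y : Fin (K + 2) → ℝ, topForm (K + 2) (ι ℝ x * ι ℝ y * (w.map (ι ℝ)).prod)
      = Matrix.det (Matrix.of (Matrix.vecCons x (Matrix.vecCons y fun i : Fin K => w.get (i.cast hK)))) := by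
    intro x y
    rw [← topForm_ofFn]
    congr 1
    rw [List.ofFn_succ, List.ofFn_succ]
    simp only [List.prod_cons, mul_assoc, Matrix.cons_val_zero, Matrix.cons_val_succ]
    congr 3
    refine List.ext_getElem (by simp [hK]) fun i h₁ h₂ => ?_
    simp
  set M := Matrix.of (Matrix.vecCons a (Matrix.vecCons b fun i : Fin K => w.get (i.cast hK))) with hM
  have h := congrArg (fun v => topForm (K + 2) (ι ℝ v * ι ℝ d * (w.map (ι ℝ)).prod))
    (Matrix.mulVec_cramer M.transpose c)
  have hlin : ∀ v, topForm (K + 2) (ι ℝ v * ι ℝ d * (w.map (ι ℝ)).prod) =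
      (topForm (K + 2) ∘ₗ LinearMap.mulRight ℝ (ι ℝ d * (w.map (ι ℝ)).prod) ∘ₗ ι ℝ) v := by
    intro v
    simp [mul_assoc]
  have hrow : ∀ i : Fin K, topForm (K + 2) (ι ℝ (M i.succ.succ) * ι ℝ d * (w.map (ι ℝ)).prod) = 0 := by
    intro i
    rw [key]
    refine Matrix.det_zero_of_row_eq (i := 0) (j := i.succ.succ) (Fin.succ_ne_zero _).symm ?_
    rfl
  have h0 : (M.updateRow 0 c).det = topForm (K + 2) (ι ℝ c * ι ℝ b * (w.map (ι ℝ)).prod) := by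
    rw [key]
    congr 1
    ext i j
    refine Fin.cases ?_ (fun i => Fin.cases ?_ (fun i => ?_) i) i <;> simp [hM, Matrix.updateRow_apply]
  have h1 : (M.updateRow 1 c).det = topForm (K + 2) (ι ℝ a * ι ℝ c * (w.map (ι ℝ)).prod) := by
    rw [key]
    congr 1
    ext i j
    refine Fin.cases ?_ (fun i => Fin.cases ?_ (fun i => ?_) i) i
    · simp [hM, Matrix.updateRow_apply]
    · simp [hM, Matrix.updateRow_apply]
    · have : i.succ.succ ≠ 1 := fun h => Fin.succ_ne_zero i (Fin.succ_injective _ h)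
      simp [hM, Matrix.updateRow_apply, this]
  have hanti : ∀ x y : Fin (K + 2) → ℝ, ι ℝ x * ι ℝ y = - (ι ℝ y * ι ℝ x) := fun x y =>
    eq_neg_of_add_eq_zero_left (ι_add_mul_swap x y)
  simp only [Matrix.mulVec_eq_sum, Matrix.det_transpose, Matrix.transpose_transpose,
    op_smul_eq_smul] at h
  rw [hlin, hlin, map_sum] at h
  simp only [map_smul] at h
  rw [Fin.sum_univ_succ, Fin.sum_univ_succ, Finset.sum_eq_zero] at h
  · simp only [← hlin, smul_eq_mul, Matrix.cramer_transpose_apply] at h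
    rw [hanti c b, neg_mul, map_neg] at h0
    rw [h0, show (Fin.succ 0 : Fin (K + 2)) = 1 from rfl, h1,
      show M 0 = a from rfl, show M 1 = b from rfl,
      show M.det = topForm (K + 2) (ι ℝ a * ι ℝ b * (w.map (ι ℝ)).prod) from (key a b).symm] at h
    linarith
  · intro i _
    rw [← hlin, hrow, smul_zero]

/-- The exterior product of `len` consecutive terms of `u`, starting at index `a`. -/
noncomputable def wedgeRange {k : ℕ} (u : ℕ → Fin k → ℝ) (a len : ℕ) :
    ExteriorAlgebra ℝ (Fin k → ℝ) :=
  ((List.range' a len).map fun t => ι ℝ (u t)).prod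

section wedgeRange

variable {k : ℕ} (u : ℕ → Fin k → ℝ)

@[simp] lemma wedgeRange_zero (a : ℕ) : wedgeRange u a 0 = 1 := by simp [wedgeRange]

lemma wedgeRange_succ_left (a len : ℕ) :
    wedgeRange u a (len + 1) = ι ℝ (u a) * wedgeRange u (a + 1) len := by
  simp [wedgeRange, List.range'_succ]

lemma wedgeRange_mul (a m l : ℕ) :
    wedgeRange u a m * wedgeRange u (a + m) l = wedgeRange u a (m + l) := by
  simp [wedgeRange, ← List.range'_append_1]

lemma wedgeRange_succ_right (a len : ℕ) :
    wedgeRange u a (len + 1) = wedgeRange u a len * ι ℝ (u (a + len)) := by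
  rw [← wedgeRange_mul, wedgeRange_succ_left, wedgeRange_zero, mul_one]

variable {u} in
lemma wedgeRange_congr {v : ℕ → Fin k → ℝ} {a len : ℕ}
    (h : ∀ t, a ≤ t → t < a + len → u t = v t) : wedgeRange u a len = wedgeRange v a len := by
  unfold wedgeRange
  congr 1
  refine List.map_congr_left fun t ht => ?_
  rw [List.mem_range'_1] at ht
  rw [h t ht.1 ht.2]

lemma ι_mul_wedgeRange (x : Fin k → ℝ) (a len : ℕ) :
    ι ℝ x * wedgeRange u a len = (-1 : ℝ) ^ len • (wedgeRange u a len * ι ℝ x) := by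
  induction len generalizing a with
  | zero => simp
  | succ len ih =>
    rw [wedgeRange_succ_left, ← mul_assoc, eq_neg_of_add_eq_zero_left (ι_add_mul_swap x (u a)),
      neg_mul, mul_assoc, ih, mul_smul_comm, pow_succ, mul_neg_one, neg_smul, mul_assoc]

lemma wedgeRange_mul_ι (x : Fin k → ℝ) (a len : ℕ) :
    wedgeRange u a len * ι ℝ x = (-1 : ℝ) ^ len • (ι ℝ x * wedgeRange u a len) := by
  rw [ι_mul_wedgeRange, smul_smul, ← mul_pow]
  simp

lemma wedgeRange_mul_ι_of_mem {a len t : ℕ} (h₁ : a ≤ t) (h₂ : t < a + len) :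
    wedgeRange u a len * ι ℝ (u t) = 0 := by
  obtain ⟨s, rfl⟩ := Nat.exists_eq_add_of_le h₁
  obtain ⟨r, rfl⟩ := Nat.exists_eq_add_of_le (show s + 1 ≤ len by omega)
  rw [← wedgeRange_mul, wedgeRange_succ_right, mul_assoc, wedgeRange_mul_ι _ _ (a + (s + 1)), mul_smul_comm,
    mul_assoc, ← mul_assoc (ι ℝ (u (a + s))), ι_sq_zero]
  simp

/-- The determinant of the `k - m` vectors `u_{i+m}, …, u_{i+k-1}` followed by the `m` vectors
`u_{i+l+k}, …, u_{i+l+k+m-1}`. -/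
noncomputable def twoBlockMinor (m l i : ℕ) : ℝ :=
  topForm k (wedgeRange u (i + m) (k - m) * wedgeRange u (i + l + k) m)

lemma twoBlockMinor_zero (l i : ℕ) : twoBlockMinor u 0 l i = topForm k (wedgeRange u i k) := by
  simp [twoBlockMinor]

lemma twoBlockMinor_gap_zero {m : ℕ} (hm : m ≤ k) (i : ℕ) :
    twoBlockMinor u m 0 i = topForm k (wedgeRange u (i + m) k) := by
  rw [twoBlockMinor, show i + 0 + k = i + m + (k - m) by omega, wedgeRange_mul,
    Nat.sub_add_cancel hm]

lemma twoBlockMinor_full (l i : ℕ) :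
    twoBlockMinor u k l i = topForm k (wedgeRange u (i + l + k) k) := by
  simp [twoBlockMinor]

lemma twoBlockMinor_octahedron {m l : ℕ} (hm : m + 1 < k) (i : ℕ) :
    twoBlockMinor u (m + 1) (l + 1) i * twoBlockMinor u (m + 1) (l + 1) (i + 1) =
      twoBlockMinor u (m + 1) (l + 2) i * twoBlockMinor u (m + 1) l (i + 1) +
      twoBlockMinor u (m + 2) (l + 1) i * twoBlockMinor u m (l + 1) (i + 1) := by
  obtain ⟨s, rfl⟩ : ∃ s, k = m + 1 + (s + 1) := ⟨k - m - 2, by omega⟩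
  set P := wedgeRange u (i + m + 2) s with hP
  set Q := wedgeRange u (i + l + 2 + (m + 1 + (s + 1))) m with hQ
  set α := u (i + m + 1) with hα
  set β := u (i + (m + 1 + (s + 1))) with hβ
  set γ := u (i + l + 1 + (m + 1 + (s + 1))) with hγ
  set δ := u (i + l + 2 + (m + 1 + (s + 1)) + m) with hδ
  have e1 : wedgeRange u (i + (m + 1)) (m + 1 + (s + 1) - (m + 1)) = ι ℝ α * P := by
    rw [show m + 1 + (s + 1) - (m + 1) = s + 1 by omega, wedgeRange_succ_left, hα, hP]
    rfl
  have e2 : wedgeRange u (i + (l + 1) + (m + 1 + (s + 1))) (m + 1) = ι ℝ γ * Q := by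
    rw [wedgeRange_succ_left, hγ, hQ,
      show i + (l + 1) + (m + 1 + (s + 1)) + 1 = i + l + 2 + (m + 1 + (s + 1)) by ring]
    rfl
  have e3 : wedgeRange u (i + 1 + (m + 1)) (m + 1 + (s + 1) - (m + 1)) = P * ι ℝ β := by
    rw [show m + 1 + (s + 1) - (m + 1) = s + 1 by omega, wedgeRange_succ_right, hβ, hP,
      show i + 1 + (m + 1) = i + m + 2 by ring, show i + (m + 1 + (s + 1)) = i + m + 2 + s by ring]
  have e4 : wedgeRange u (i + 1 + (l + 1) + (m + 1 + (s + 1))) (m + 1) = Q * ι ℝ δ := by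
    rw [wedgeRange_succ_right, hδ, hQ, show i + 1 + (l + 1) = i + l + 2 by ring]
  have e5 : wedgeRange u (i + (m + 2)) (m + 1 + (s + 1) - (m + 2)) = P := by
    rw [show m + 1 + (s + 1) - (m + 2) = s by omega, hP]
    rfl
  have e6 : wedgeRange u (i + 1 + m) (m + 1 + (s + 1) - m) = ι ℝ α * (P * ι ℝ β) := by
    rw [show m + 1 + (s + 1) - m = s + 1 + 1 by omega, wedgeRange_succ_left,
      wedgeRange_succ_right, hα, hβ, hP, show i + 1 + m + 1 = i + m + 2 by ring,
      show i + (m + 1 + (s + 1)) = i + m + 2 + s by ring, show i + 1 + m = i + m + 1 by ring]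
  have e7 : wedgeRange u (i + (l + 1) + (m + 1 + (s + 1))) (m + 2) = ι ℝ γ * (Q * ι ℝ δ) := by
    rw [wedgeRange_succ_left, wedgeRange_succ_right, hγ, hQ, hδ,
      show i + (l + 1) + (m + 1 + (s + 1)) + 1 = i + l + 2 + (m + 1 + (s + 1)) by ring]
    rfl
  have e8 : wedgeRange u (i + 1 + (l + 1) + (m + 1 + (s + 1))) m = Q := by
    rw [hQ, show i + 1 + (l + 1) = i + l + 2 by ring]
  have e9 : wedgeRange u (i + 1 + l + (m + 1 + (s + 1))) (m + 1) = ι ℝ γ * Q := by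
    rw [← e2, show i + 1 + l = i + (l + 1) by ring]
  have e10 : wedgeRange u (i + (l + 2) + (m + 1 + (s + 1))) (m + 1) = Q * ι ℝ δ := by
    rw [← e4, show i + 1 + (l + 1) = i + (l + 2) by ring]
  have hPx : ∀ x y, P * (ι ℝ x * y) = (-1 : ℝ) ^ s • (ι ℝ x * (P * y)) := fun x y => by
    rw [← mul_assoc, hP, wedgeRange_mul_ι, smul_mul_assoc, mul_assoc]
  have hQx : ∀ x, Q * ι ℝ x = (-1 : ℝ) ^ m • (ι ℝ x * Q) := fun x => wedgeRange_mul_ι u x _ _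
  have hs : (-1 : ℝ) ^ s * (-1) ^ s = 1 := by rw [← mul_pow]; simp
  have h3 := topForm_three_term (k := m + 1 + (s + 1))
    (((List.range' (i + m + 2) s).map u) ++
      ((List.range' (i + l + 2 + (m + 1 + (s + 1))) m).map u)) (by simp; omega) α γ β δ
  have hW : ((((List.range' (i + m + 2) s).map u) ++
      ((List.range' (i + l + 2 + (m + 1 + (s + 1))) m).map u)).map (ι ℝ)).prod = P * Q := by
    simp [hP, hQ, wedgeRange, Function.comp_def]
  rw [hW] at h3
  simp only [twoBlockMinor, e1, e2, e3, e4, e5, e6, e7, e8, e9, e10]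
  simp only [mul_assoc, hQx, hPx, mul_smul_comm, map_smul, smul_smul, smul_eq_mul, hs, one_mul] at h3 ⊢
  have hanti : topForm (m + 1 + (s + 1)) (ι ℝ γ * (ι ℝ β * (P * Q))) =
      - topForm (m + 1 + (s + 1)) (ι ℝ β * (ι ℝ γ * (P * Q))) := by
    rw [← map_neg, ← mul_assoc, eq_neg_of_add_eq_zero_left (ι_add_mul_swap γ β), neg_mul, mul_assoc]
  rw [hanti] at h3
  linear_combination ((-1) ^ s * (-1) ^ m) * h3

lemma wedgeRange_mul_comm (a b m l : ℕ) :
    wedgeRange u a m * wedgeRange u b l =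
      (-1 : ℝ) ^ (m * l) • (wedgeRange u b l * wedgeRange u a m) := by
  induction m generalizing a with
  | zero => simp
  | succ m ih =>
    rw [wedgeRange_succ_left, mul_assoc, ih, mul_smul_comm, ← mul_assoc, ι_mul_wedgeRange,
      smul_mul_assoc, smul_smul, mul_assoc, ← pow_add, add_mul, one_mul]

variable {u} in
lemma wedgeRange_add_period {n : ℕ} {c : ℝ} (h : ∀ t, u (t + n) = c • u t) (a len : ℕ) :
    wedgeRange u (a + n) len = c ^ len • wedgeRange u a len := by
  induction len generalizing a with
  | zero => simp
  | succ len ih =>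
    rw [wedgeRange_succ_left, wedgeRange_succ_left, add_right_comm, ih, h, map_smul,
      smul_mul_smul_comm, pow_succ']

variable {u} in
lemma twoBlockMinor_add_period {n : ℕ} {c : ℝ} (h : ∀ t, u (t + n) = c • u t) {m : ℕ}
    (hm : m ≤ k) (l i : ℕ) :
    twoBlockMinor u m l (i + n) = c ^ k * twoBlockMinor u m l i := by
  rw [twoBlockMinor, show i + n + m = i + m + n by ring, show i + n + l + k = i + l + k + n by ring,
    wedgeRange_add_period h, wedgeRange_add_period h, smul_mul_smul_comm, ← pow_add,
    Nat.sub_add_cancel hm, map_smul, smul_eq_mul, twoBlockMinor]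

variable {u} in
lemma twoBlockMinor_gap_full {L : ℕ} {q : ℝ}
    (h : ∀ t, u (t + (L + k)) = ((-1) ^ (k - 1) * q) • u t) {m : ℕ} (hm : m ≤ k) (i : ℕ) :
    twoBlockMinor u m L i = q ^ m * topForm k (wedgeRange u i k) := by
  have hw : wedgeRange u i m * wedgeRange u (i + m) (k - m) = wedgeRange u i k := by
    rw [wedgeRange_mul, Nat.add_sub_cancel' hm]
  have hs : (-1 : ℝ) ^ ((k - 1) * m) * (-1) ^ ((k - m) * m) = 1 := by
    obtain ⟨s, rfl⟩ := Nat.exists_eq_add_of_le hm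
    rcases m with _ | m
    · simp
    · rw [← pow_add, show m + 1 + s - 1 = m + s by omega, show m + 1 + s - (m + 1) = s by omega]
      refine Even.neg_one_pow ?_
      rw [show (m + s) * (m + 1) + s * (m + 1) = m * (m + 1) + 2 * (s * (m + 1)) by ring]
      exact (Nat.even_mul_succ_self m).add (even_two_mul _)
  rw [twoBlockMinor, add_assoc, wedgeRange_add_period h, mul_smul_comm, wedgeRange_mul_comm, hw,
    smul_smul, map_smul, smul_eq_mul, mul_pow, ← pow_mul]
  linear_combination (q ^ m * topForm k (wedgeRange u i k)) * hs

end wedgeRange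

lemma exists_forall_eq_of_triangular {V : Type*} [AddCommGroup V] [Module ℝ V]
    (φ : ℕ → V →ₗ[ℝ] ℝ) (e : ℕ → V) (k : ℕ) (h0 : ∀ m r, m < r → r < k → φ m (e r) = 0)
    (h1 : ∀ m < k, φ m (e m) ≠ 0) (g : ℕ → ℝ) : ∃ x, ∀ m < k, φ m x = g m := by
  induction k with
  | zero => exact ⟨0, by simp⟩
  | succ k ih =>
    obtain ⟨x, hx⟩ := ih (fun m r h h' => h0 m r h (by omega)) fun m h => h1 m (by omega)
    refine ⟨x + ((g k - φ k x) / φ k (e k)) • e k, fun m hm => ?_⟩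
    rcases Nat.lt_succ_iff_lt_or_eq.1 hm with h | rfl
    · simp [hx m h, h0 m k h (by omega)]
    · simp [div_mul_cancel₀ _ (h1 m hm)]

/-- Any array with the boundary values of a rectangular grid of two-block minors is the initial
grid of two-block minors of a quasi-periodic sequence of vectors. -/
lemma exists_twoBlockMinor_eq {k L : ℕ} (hk : 0 < k) {q : ℝ} (g : ℕ → ℕ → ℝ)
    (hg : ∀ m l, m ≤ k → l ≤ L → g m l ≠ 0) (hg0 : ∀ l ≤ L, g 0 l = 1)
    (hgL : ∀ m ≤ k, g m L = q ^ m) :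
    ∃ u : ℕ → Fin k → ℝ, (∀ t, u (t + (L + k)) = ((-1) ^ (k - 1) * q) • u t) ∧
      ∀ m l, m ≤ k → l ≤ L → twoBlockMinor u m l 0 = g m l := by
  have hn : 0 < L + k := by omega
  set c : ℝ := (-1) ^ (k - 1) * q with hc
  let ext : (ℕ → Fin k → ℝ) → ℕ → Fin k → ℝ := fun w t => c ^ (t / (L + k)) • w (t % (L + k))
  have hext : ∀ w t, ext w (t + (L + k)) = c • ext w t := by
    intro w t
    simp only [ext, Nat.add_div_right t hn, Nat.add_mod_right, pow_succ', mul_smul]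
  let e : ℕ → Fin k → ℝ := fun t => if h : t < k then Pi.single ⟨t, h⟩ 1 else 0
  have hdet : ∀ u : ℕ → Fin k → ℝ, (∀ t < k, u t = e t) → topForm k (wedgeRange u 0 k) = 1 := by
    intro u hu
    have : wedgeRange u 0 k = (List.ofFn fun i : Fin k => ι ℝ (Pi.single i (1 : ℝ))).prod := by
      rw [wedgeRange]
      congr 1
      refine List.ext_getElem (by simp) fun i h₁ h₂ => ?_
      have hi : i < k := by simpa using h₁
      simp [hu i hi, e, hi]
    rw [this, topForm_ofFn]
    convert Matrix.det_one (n := Fin k) (R := ℝ)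
    ext i j
    simp [Pi.single_apply, Matrix.one_apply, eq_comm]
  suffices H : ∀ s ≤ L, ∃ w : ℕ → Fin k → ℝ, (∀ t < k, w t = e t) ∧
      ∀ m l, m ≤ k → l ≤ L → L ≤ l + s → twoBlockMinor (ext w) m l 0 = g m l by
    obtain ⟨w, -, hw⟩ := H L le_rfl
    exact ⟨ext w, hext w, fun m l hm hl => hw m l hm hl (by omega)⟩
  have hext_lt : ∀ w t, t < L + k → ext w t = w t := by
    intro w t ht
    simp [ext, Nat.div_eq_of_lt ht, Nat.mod_eq_of_lt ht]
  intro s hs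
  induction s with
  | zero =>
    refine ⟨e, fun _ _ => rfl, fun m l hm hl hl' => ?_⟩
    obtain rfl : l = L := by omega
    rw [twoBlockMinor_gap_full (hext e) hm, hgL m hm, hdet, mul_one]
    exact fun t ht => hext_lt e t (by omega)
  | succ s ih =>
    obtain ⟨w, hwe, hw⟩ := ih (by omega)
    obtain ⟨l, hl⟩ : ∃ l, l + (s + 1) = L := ⟨L - (s + 1), by omega⟩
    let φ : ℕ → (Fin k → ℝ) →ₗ[ℝ] ℝ := fun m =>
      topForm k ∘ₗ LinearMap.mulLeft ℝ (wedgeRange e (m + 1) (k - (m + 1))) ∘ₗ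
        LinearMap.mulRight ℝ (wedgeRange (ext w) (l + k + 1) m) ∘ₗ ι ℝ
    have hφ : ∀ m x, φ m x = topForm k (wedgeRange e (m + 1) (k - (m + 1)) *
        (ι ℝ x * wedgeRange (ext w) (l + k + 1) m)) := fun m x => rfl
    have h0 : ∀ m r, m < r → r < k → φ m (e r) = 0 := by
      intro m r hmr hr
      rw [hφ, ← mul_assoc, wedgeRange_mul_ι_of_mem e (by omega) (by omega), zero_mul, map_zero]
    have h1 : ∀ m < k, φ m (e m) ≠ 0 := by
      intro m hm
      have h := hw m (l + 1) (by omega) (by omega) (by omega)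
      rw [twoBlockMinor, show k - m = k - (m + 1) + 1 by omega, wedgeRange_succ_left, zero_add,
        hext_lt _ _ (by omega), hwe m hm, ι_mul_wedgeRange, zero_add, smul_mul_assoc, map_smul,
        add_right_comm, smul_eq_mul, mul_assoc] at h
      rw [hφ]
      rw [wedgeRange_congr (v := e) fun t h₁ h₂ => by
        rw [hext_lt _ _ (by omega), hwe t (by omega)]] at h
      intro h0
      rw [h0, mul_zero] at h
      exact hg m (l + 1) (by omega) (by omega) h.symm
    obtain ⟨x, hx⟩ := exists_forall_eq_of_triangular φ e k h0 h1 fun m => g (m + 1) l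
    refine ⟨Function.update w (l + k) x, ?_, ?_⟩
    · intro t ht
      rw [Function.update_of_ne (by omega), hwe t ht]
    · intro m l' hm hl' hll'
      have hagree : ∀ t, t < l + k + (L + k) → t ≠ l + k →
          ext (Function.update w (l + k) x) t = ext w t := by
        intro t ht hne
        simp only [ext]
        rw [Function.update_of_ne]
        rcases lt_or_ge t (L + k) with h | h
        · rwa [Nat.mod_eq_of_lt h]
        · rw [Nat.mod_eq_sub_mod h, Nat.mod_eq_of_lt (by omega)]
          omega
      rcases Nat.lt_or_ge l l' with h | h
      · rw [← hw m l' hm hl' (by omega), twoBlockMinor, twoBlockMinor]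
        congr 2 <;> refine wedgeRange_congr fun t h₁ h₂ => hagree t (by omega) (by omega)
      · obtain rfl : l' = l := by omega
        rcases m with _ | m
        · rw [twoBlockMinor_zero, hg0 _ hl', hdet]
          intro t ht
          rw [hagree t (by omega) (by omega), hext_lt _ _ (by omega), hwe t ht]
        · rw [← hx m (by omega), hφ, twoBlockMinor, wedgeRange_succ_left]
          congr 2
          · rw [zero_add]
            refine wedgeRange_congr fun t h₁ h₂ => ?_
            rw [hagree t (by omega) (by omega), hext_lt _ _ (by omega), hwe t (by omega)]
          · congr 1
            · rw [zero_add, hext_lt _ _ (by omega), Function.update_self]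
            · rw [zero_add]
              exact wedgeRange_congr fun t h₁ h₂ => hagree t (by omega) (by omega)

end Wedge

section Tropicalization

/-- `g` has the exact polynomial growth rate `e` on `[1, ∞)`. -/
def HasGrowth (g : ℝ → ℝ) (e : ℕ) : Prop :=
  ∃ C : ℝ, 0 < C ∧ ∀ t, 1 ≤ t → t ^ e ≤ C * g t ∧ g t ≤ C * t ^ e

namespace HasGrowth

variable {f g h : ℝ → ℝ} {a b : ℕ}

lemma pos (hf : HasGrowth f a) {t : ℝ} (ht : 1 ≤ t) : 0 < f t := by
  obtain ⟨C, hC, hCt⟩ := hf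
  exact pos_of_mul_pos_right ((pow_pos (by linarith) a).trans_le (hCt t ht).1) hC.le

lemma congr (hf : HasGrowth f a) (hfg : ∀ t, 1 ≤ t → g t = f t) : HasGrowth g a := by
  obtain ⟨C, hC, hCt⟩ := hf
  exact ⟨C, hC, fun t ht => by rw [hfg t ht]; exact hCt t ht⟩

lemma pow (a : ℕ) : HasGrowth (fun t => t ^ a) a :=
  ⟨1, one_pos, fun t _ => by simp⟩

lemma mul (hf : HasGrowth f a) (hg : HasGrowth g b) : HasGrowth (fun t => f t * g t) (a + b) := by
  have hf0 := fun t => hf.pos (t := t)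
  have hg0 := fun t => hg.pos (t := t)
  obtain ⟨C, hC, hCt⟩ := hf
  obtain ⟨D, hD, hDt⟩ := hg
  refine ⟨C * D, by positivity, fun t ht => ?_⟩
  have := hf0 t ht
  have := hg0 t ht
  rw [pow_add]
  constructor
  · calc t ^ a * t ^ b ≤ (C * f t) * (D * g t) :=
          mul_le_mul (hCt t ht).1 (hDt t ht).1 (by positivity) (by positivity)
      _ = _ := by ring
  · calc f t * g t ≤ (C * t ^ a) * (D * t ^ b) :=
          mul_le_mul (hCt t ht).2 (hDt t ht).2 (by positivity) (by positivity)
      _ = _ := by ring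

lemma add (hf : HasGrowth f a) (hg : HasGrowth g b) :
    HasGrowth (fun t => f t + g t) (max a b) := by
  have hf0 := fun t => hf.pos (t := t)
  have hg0 := fun t => hg.pos (t := t)
  obtain ⟨C, hC, hCt⟩ := hf
  obtain ⟨D, hD, hDt⟩ := hg
  refine ⟨C + D, by positivity, fun t ht => ?_⟩
  have h1 := hf0 t ht
  have h2 := hg0 t ht
  obtain ⟨hC1, hC2⟩ := hCt t ht
  obtain ⟨hD1, hD2⟩ := hDt t ht
  constructor
  · rcases max_choice a b with h | h <;> rw [h]
    · nlinarith [mul_pos hC h2, mul_pos hD h1, mul_pos hD h2]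
    · nlinarith [mul_pos hC h2, mul_pos hD h1, mul_pos hC h1]
  · have h3 : t ^ a ≤ t ^ max a b := pow_le_pow_right₀ ht (le_max_left _ _)
    have h4 : t ^ b ≤ t ^ max a b := pow_le_pow_right₀ ht (le_max_right _ _)
    nlinarith

lemma of_mul_left (hf : HasGrowth f a) (h : HasGrowth (fun t => f t * g t) (a + b)) :
    HasGrowth g b := by
  have hf0 := fun t => hf.pos (t := t)
  have hh0 := fun t => h.pos (t := t)
  obtain ⟨C, hC, hCt⟩ := hf
  obtain ⟨D, hD, hDt⟩ := h
  refine ⟨C * D, by positivity, fun t ht => ?_⟩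
  have h1 := hf0 t ht
  have h2 : 0 < g t := pos_of_mul_pos_right (hh0 t ht) h1.le
  obtain ⟨hC1, hC2⟩ := hCt t ht
  obtain ⟨hD1, hD2⟩ := hDt t ht
  have hta : 0 < t ^ a := pow_pos (by linarith) a
  rw [pow_add] at hD1 hD2
  constructor
  · refine le_of_mul_le_mul_left ?_ hta
    calc t ^ a * t ^ b ≤ D * (f t * g t) := hD1
      _ = D * g t * f t := by ring
      _ ≤ D * g t * (C * t ^ a) := mul_le_mul_of_nonneg_left hC2 (by positivity)
      _ = _ := by ring
  · refine le_of_mul_le_mul_left ?_ hta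
    calc t ^ a * g t ≤ C * f t * g t := mul_le_mul_of_nonneg_right hC1 h2.le
      _ = C * (f t * g t) := by ring
      _ ≤ C * (D * (t ^ a * t ^ b)) := mul_le_mul_of_nonneg_left hD2 hC.le
      _ = _ := by ring

lemma le (hf : HasGrowth f a) (hf' : HasGrowth f b) : b ≤ a := by
  obtain ⟨C, hC, hCt⟩ := hf
  obtain ⟨D, hD, hDt⟩ := hf'
  by_contra! hab
  obtain ⟨s, rfl⟩ := Nat.exists_eq_add_of_lt hab
  have ht : 1 ≤ D * C + 1 := by nlinarith [mul_pos hD hC]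
  have h1 := (hCt _ ht).2
  have h2 := (hDt _ ht).1
  set t := D * C + 1 with htd
  have hta : 0 < t ^ a := pow_pos (by linarith) a
  have h3 : t ^ a * t ≤ t ^ (a + s + 1) := by
    rw [← pow_succ]
    exact pow_le_pow_right₀ ht (by omega)
  have h4 : D * f t ≤ D * (C * t ^ a) := mul_le_mul_of_nonneg_left h1 hD.le
  have h5 : t ^ a * t = t ^ a + D * (C * t ^ a) := by rw [htd]; ring
  linarith

lemma unique (hf : HasGrowth f a) (hf' : HasGrowth f b) : a = b :=
  le_antisymm (hf'.le hf) (hf.le hf')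

end HasGrowth

/-- One time step of the tropical octahedron recurrence on the grid `[0, k] × [0, L]`, with the
boundary behaviour of partial row sums of the partitions attached to a rectangular tableau. -/
structure TropicalStep (k L d : ℕ) (A B : ℕ → ℕ → ℕ) : Prop where
  zero : ∀ l ≤ L, B 0 l = 0
  gap_full : ∀ m ≤ k, B m L = m * d
  gap_zero : ∀ m < k, B m 0 + A 1 0 = A (m + 1) 0
  full : ∀ l < L, B k l + A 1 0 = A k (l + 1)
  octahedron : ∀ m l, m + 1 < k → l + 1 < L →
    A (m + 1) (l + 1) + B (m + 1) (l + 1) =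
      max (A (m + 1) (l + 2) + B (m + 1) l) (A (m + 2) (l + 1) + B m (l + 1))

theorem TropicalStep.periodic {k L d : ℕ} (hk : 0 < k) (f : ℕ → ℕ → ℕ → ℕ)
    (h0 : ∀ l ≤ L, f 0 0 l = 0) (hL : ∀ m ≤ k, f 0 m L = m * d)
    (hf : ∀ i < L + k, TropicalStep k L d (f i) (f (i + 1))) {m l : ℕ} (hm : m ≤ k) (hl : l ≤ L) :
    f (L + k) m l = f 0 m l := by
  have hex : ∀ t : ℝ, ∃ u : ℕ → Fin k → ℝ, 1 ≤ t →
      (∀ s, u (s + (L + k)) = ((-1) ^ (k - 1) * t ^ d) • u s) ∧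
      ∀ m l, m ≤ k → l ≤ L → twoBlockMinor u m l 0 = t ^ f 0 m l := by
    intro t
    by_cases ht : 1 ≤ t
    · obtain ⟨u, hu⟩ := exists_twoBlockMinor_eq hk (q := t ^ d) (fun m l => t ^ f 0 m l)
        (fun m l _ _ => (pow_pos (by linarith) _).ne') (fun l hl => by rw [h0 l hl, pow_zero])
        (fun m hm => by rw [hL m hm, ← pow_mul, mul_comm])
      exact ⟨u, fun _ => hu⟩
    · exact ⟨0, fun h => absurd h ht⟩
  choose u hu using hex
  let C : ℕ → ℕ := fun i => ∑ s ∈ Finset.range i, f s 1 0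
  have hC : ∀ i, C (i + 1) = C i + f i 1 0 := fun i => Finset.sum_range_succ _ _
  have key : ∀ i ≤ L + k, ∀ m ≤ k, ∀ l ≤ L,
      HasGrowth (fun t => twoBlockMinor (u t) m l i) (f i m l + C i) := by
    intro i
    induction i with
    | zero =>
      intro _ m hm l hl
      have : f 0 m l + C 0 = f 0 m l := by simp [C]
      rw [this]
      exact (HasGrowth.pow _).congr fun t ht => (hu t ht).2 m l hm hl
    | succ i ih =>
      intro hi
      have ih := ih (by omega)
      have hs := hf i (by omega)
      have hp : HasGrowth (fun t => topForm k (wedgeRange (u t) (i + 1) k)) (C (i + 1)) := by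
        have := ih 1 hk 0 (Nat.zero_le _)
        rw [hC, add_comm (C i)]
        exact this.congr fun t _ => (twoBlockMinor_gap_zero (u t) (m := 1) hk i).symm
      intro m
      induction m with
      | zero =>
        intro _ l hl
        rw [hs.zero l hl, zero_add]
        exact hp.congr fun t _ => twoBlockMinor_zero _ _ _
      | succ m ihm =>
        intro hm l
        induction l with
        | zero =>
          intro hl
          rcases Nat.lt_or_ge (m + 1) k with h | h
          · have e : f (i + 1) (m + 1) 0 + C (i + 1) = f i (m + 2) 0 + C i := by
              have : f (i + 1) (m + 1) 0 + f i 1 0 = f i (m + 2) 0 := hs.gap_zero (m + 1) h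
              rw [hC]
              omega
            rw [e]
            refine (ih (m + 2) h 0 hl).congr fun t _ => ?_
            rw [twoBlockMinor_gap_zero _ hm, twoBlockMinor_gap_zero _ (m := m + 2) h]
            congr 2
            omega
          · obtain rfl : m + 1 = k := by omega
            rcases Nat.eq_zero_or_pos L with rfl | hL0
            · rw [hs.gap_full _ le_rfl]
              refine ((HasGrowth.pow ((m + 1) * d)).mul hp).congr fun t ht => ?_
              rw [twoBlockMinor_gap_full (hu t ht).1 le_rfl, ← pow_mul, mul_comm d]
            · have e : f (i + 1) (m + 1) 0 + C (i + 1) = f i (m + 1) 1 + C i := by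
                have : f (i + 1) (m + 1) 0 + f i 1 0 = f i (m + 1) 1 := hs.full 0 hL0
                rw [hC]
                omega
              rw [e]
              refine (ih (m + 1) le_rfl 1 hL0).congr fun t _ => ?_
              rw [twoBlockMinor_full, twoBlockMinor_full]
        | succ l ihl =>
          intro hl
          have ihl := ihl (by omega)
          rcases Nat.eq_or_lt_of_le hl with rfl | hl
          · rw [hs.gap_full _ hm]
            refine ((HasGrowth.pow ((m + 1) * d)).mul hp).congr fun t ht => ?_
            rw [twoBlockMinor_gap_full (hu t ht).1 hm, ← pow_mul, mul_comm d]
          · rcases Nat.eq_or_lt_of_le hm with rfl | hm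
            · have e : f (i + 1) (m + 1) (l + 1) + C (i + 1) = f i (m + 1) (l + 2) + C i := by
                have : f (i + 1) (m + 1) (l + 1) + f i 1 0 = f i (m + 1) (l + 2) :=
                  hs.full (l + 1) hl
                rw [hC]
                omega
              rw [e]
              refine (ih (m + 1) le_rfl (l + 2) hl).congr fun t _ => ?_
              rw [twoBlockMinor_full, twoBlockMinor_full]
              congr 2
              ring
            · refine (ih (m + 1) hm.le (l + 1) hl.le).of_mul_left ?_
              have h1 := (ih (m + 1) hm.le (l + 2) hl).mul ihl
              have h2 := (ih (m + 2) hm (l + 1) hl.le).mul (ihm (by omega) (l + 1) hl.le)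
              have e := hs.octahedron m l hm hl
              have e' : f i (m + 1) (l + 1) + C i + (f (i + 1) (m + 1) (l + 1) + C (i + 1)) =
                  max (f i (m + 1) (l + 2) + C i + (f (i + 1) (m + 1) l + C (i + 1)))
                    (f i (m + 2) (l + 1) + C i + (f (i + 1) m (l + 1) + C (i + 1))) := by
                omega
              rw [e']
              exact (h1.add h2).congr fun t _ => twoBlockMinor_octahedron (u t) hm i
  have hper : ∀ m ≤ k, ∀ l ≤ L, f (L + k) m l + C (L + k) = k * d + f 0 m l := by
    intro m hm l hl
    refine (key (L + k) le_rfl m hm l hl).unique ((HasGrowth.pow _).congr fun t ht => ?_)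
    have h := twoBlockMinor_add_period (hu t ht).1 hm l 0
    rw [zero_add] at h
    have he : Even ((k - 1) * k) := by
      obtain ⟨s, rfl⟩ := Nat.exists_eq_succ_of_ne_zero hk.ne'
      exact Nat.even_mul_succ_self s
    rw [h, (hu t ht).2 m l hm hl, mul_pow, ← pow_mul, ← pow_mul, he.neg_one_pow, one_mul,
      ← pow_add, mul_comm d]
  have hC0 := hper 0 (Nat.zero_le _) l hl
  have h00 : f (L + k) 0 l = 0 := by
    obtain ⟨s, hs⟩ := Nat.exists_eq_succ_of_ne_zero (show L + k ≠ 0 by omega)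
    rw [hs]
    exact (hf s (by omega)).zero l hl
  have := hper m hm l hl
  rw [h0 l hl] at hC0
  omega

end Tropicalization
section Patterns

/-- Gelfand–Tsetlin patterns of rectangular top row: `Γ j` is the partition formed by the entries
`≤ j` of a tableau. -/
structure IsGTPattern (k d n : ℕ) (Γ : ℕ → ℕ → ℕ) : Prop where
  mono : ∀ j r, Γ j r ≤ Γ (j + 1) r
  interlace : ∀ j r, Γ (j + 1) (r + 1) ≤ Γ j r
  le : ∀ j r, Γ j r ≤ d
  bot : ∀ r, Γ 0 r = 0
  top : ∀ r < k, Γ n r = d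
  outside : ∀ j r, k ≤ r → Γ j r = 0

/-- `Γ j r` counts the entries `≤ j` in row `r` of `T`. -/
def Encodes (k d : ℕ) (T Γ : ℕ → ℕ → ℕ) : Prop :=
  ∀ r c j, r < k → c < d → (T r c ≤ j ↔ c < Γ j r)

/-- The number of entries `≤ j` in row `r` of `T`. -/
def rowCount (k d : ℕ) (T : ℕ → ℕ → ℕ) (j r : ℕ) : ℕ :=
  if r < k then ((Finset.range d).filter fun c => T r c ≤ j).card else 0

lemma Encodes.eq_rowCount {k d n : ℕ} {T Γ : ℕ → ℕ → ℕ} (h : Encodes k d T Γ)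
    (hΓ : IsGTPattern k d n Γ) : Γ = rowCount k d T := by
  funext j r
  unfold rowCount
  split_ifs with hr
  · have : ((Finset.range d).filter fun c => T r c ≤ j) = Finset.range (Γ j r) := by
      ext c
      have := h r c j hr
      have := hΓ.le j r
      simp only [Finset.mem_filter, Finset.mem_range]
      constructor
      · rintro ⟨h1, h2⟩
        exact (h r c j hr h1).1 h2
      · intro h1
        exact ⟨by omega, (h r c j hr (by omega)).2 h1⟩
    rw [this, Finset.card_range]
  · exact hΓ.outside j r (by omega)

lemma IsSSYT.encodes_rowCount {k d n : ℕ} {T : ℕ → ℕ → ℕ} (hT : IsSSYT k d n T) :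
    Encodes k d T (rowCount k d T) := by
  obtain ⟨-, hrow, -⟩ := hT
  intro r c j hr hc
  have hmono : ∀ c₁ c₂, c₁ ≤ c₂ → c₂ < d → T r c₁ ≤ T r c₂ := by
    intro c₁ c₂ h
    induction c₂, h using Nat.le_induction with
    | base => intro _; exact le_rfl
    | succ c₂ _ ih => intro h; exact (ih (by omega)).trans (hrow r c₂ hr h)
  rw [rowCount, if_pos hr]
  constructor
  · intro h
    have : Finset.range (c + 1) ⊆ (Finset.range d).filter fun c => T r c ≤ j := by
      intro c' hc'
      rw [Finset.mem_range] at hc'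
      rw [Finset.mem_filter, Finset.mem_range]
      exact ⟨by omega, (hmono c' c (by omega) hc).trans h⟩
    simpa using Finset.card_le_card this
  · intro h
    by_contra! hj
    have : ((Finset.range d).filter fun c => T r c ≤ j) ⊆ Finset.range c := by
      intro c' hc'
      rw [Finset.mem_filter, Finset.mem_range] at hc'
      rw [Finset.mem_range]
      by_contra! hcc
      have := hmono c c' hcc hc'.1
      omega
    have := Finset.card_le_card this
    rw [Finset.card_range] at this
    omega

lemma IsSSYT.isGTPattern_rowCount {k d n : ℕ} {T : ℕ → ℕ → ℕ} (hT : IsSSYT k d n T) :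
    IsGTPattern k d n (rowCount k d T) := by
  obtain ⟨hval, -, hcol⟩ := hT
  constructor
  · intro j r
    unfold rowCount
    split_ifs with hr
    · refine Finset.card_le_card (Finset.monotone_filter_right _ fun c _ h => ?_)
      exact Nat.le_succ_of_le h
    · exact le_rfl
  · intro j r
    unfold rowCount
    split_ifs with hr hr'
    · refine Finset.card_le_card fun c hc => ?_
      rw [Finset.mem_filter, Finset.mem_range] at hc ⊢
      have := hcol r c hr hc.1
      exact ⟨hc.1, by omega⟩
    all_goals omega
  · intro j r
    unfold rowCount
    split_ifs with hr
    · exact (Finset.card_filter_le _ _).trans (Finset.card_range d).le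
    · exact Nat.zero_le _
  · intro r
    unfold rowCount
    split_ifs with hr
    · rw [Finset.card_eq_zero, Finset.filter_eq_empty_iff]
      intro c hc
      have := (hval r c hr (Finset.mem_range.1 hc)).1
      omega
    · rfl
  · intro r hr
    rw [rowCount, if_pos hr, Finset.filter_true_of_mem, Finset.card_range]
    exact fun c hc => (hval r c hr (Finset.mem_range.1 hc)).2
  · intro j r hr
    rw [rowCount, if_neg (by omega)]

/-- The partition `γ` shifted down by one row, with a first row of length `d` on top. -/
def shiftRow (d : ℕ) (γ : ℕ → ℕ) : ℕ → ℕ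
  | 0 => d
  | r + 1 => γ r

/-- The effect of the Bender–Knuth involution `t_{i+1}` on Gelfand–Tsetlin patterns. -/
def gtToggle (d i : ℕ) (Γ : ℕ → ℕ → ℕ) : ℕ → ℕ → ℕ := fun j r =>
  if j = i + 1 then
    min (Γ (i + 2) r) (shiftRow d (Γ i) r) + max (Γ (i + 2) (r + 1)) (Γ i r) - Γ (i + 1) r
  else Γ j r

lemma gtToggle_of_ne {d i j : ℕ} (Γ : ℕ → ℕ → ℕ) (h : j ≠ i + 1) : gtToggle d i Γ j = Γ j := by
  funext r
  rw [gtToggle, if_neg h]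

variable {k d n : ℕ} {T Γ : ℕ → ℕ → ℕ}

lemma IsGTPattern.level_le_min (hΓ : IsGTPattern k d n Γ) (i r : ℕ) :
    Γ (i + 1) r ≤ min (Γ (i + 2) r) (shiftRow d (Γ i) r) := by
  refine le_min (hΓ.mono _ _) ?_
  cases r with
  | zero => exact hΓ.le _ _
  | succ r => exact hΓ.interlace _ _

lemma IsGTPattern.max_le_level (hΓ : IsGTPattern k d n Γ) (i r : ℕ) :
    max (Γ (i + 2) (r + 1)) (Γ i r) ≤ Γ (i + 1) r :=
  max_le (hΓ.interlace _ _) (hΓ.mono _ _)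

lemma gtToggle_add (hΓ : IsGTPattern k d n Γ) (i r : ℕ) :
    gtToggle d i Γ (i + 1) r + Γ (i + 1) r =
      min (Γ (i + 2) r) (shiftRow d (Γ i) r) + max (Γ (i + 2) (r + 1)) (Γ i r) := by
  have := hΓ.level_le_min i r
  rw [gtToggle, if_pos rfl]
  omega

lemma IsGTPattern.gtToggle (hΓ : IsGTPattern k d n Γ) {i : ℕ} (hi : i + 1 < n) :
    IsGTPattern k d n (gtToggle d i Γ) := by
  have hadd := gtToggle_add hΓ i
  have h1 := hΓ.level_le_min i
  have h2 := hΓ.max_le_level i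
  have hne : ∀ j, j ≠ i + 1 → _root_.gtToggle d i Γ j = Γ j := fun j => gtToggle_of_ne Γ
  generalize _root_.gtToggle d i Γ = Δ at *
  constructor
  · intro j r
    have := hadd r
    have := h1 r
    have := h2 r
    rcases eq_or_ne j (i + 1) with rfl | hj
    · rw [hne (i + 1 + 1) (by omega)]
      change _ ≤ Γ (i + 2) r
      omega
    · rw [hne j hj]
      rcases eq_or_ne j i with rfl | hj'
      · omega
      · rw [hne (j + 1) (by omega)]
        exact hΓ.mono j r
  · intro j r
    rcases eq_or_ne j (i + 1) with rfl | hj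
    · have := hadd r
      have := h1 r
      have := h2 r
      rw [hne (i + 1 + 1) (by omega)]
      change Γ (i + 2) (r + 1) ≤ _
      omega
    · rw [hne j hj]
      rcases eq_or_ne j i with rfl | hj'
      · have h3 := hadd (r + 1)
        have := h1 (r + 1)
        have := h2 (r + 1)
        rw [shiftRow] at *
        omega
      · rw [hne (j + 1) (by omega)]
        exact hΓ.interlace j r
  · intro j r
    rcases eq_or_ne j (i + 1) with rfl | hj
    · have := hadd r
      have := h1 r
      have := h2 r
      have := hΓ.le (i + 2) r
      omega
    · rw [hne j hj]
      exact hΓ.le j r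
  · intro r
    rw [hne 0 (by omega)]
    exact hΓ.bot r
  · intro r
    rw [hne n (by omega)]
    exact hΓ.top r
  · intro j r hr
    rcases eq_or_ne j (i + 1) with rfl | hj
    · have := hadd r
      have := h1 r
      have := h2 r
      have := hΓ.outside (i + 2) r hr
      omega
    · rw [hne j hj]
      exact hΓ.outside j r hr

lemma Encodes.bkFree_iff (h : Encodes k d T Γ) (hΓ : IsGTPattern k d n Γ) (i : ℕ) {r c : ℕ}
    (hr : r < k) (hc : c < d) :
    bkFree k (i + 1) T r c ↔ max (Γ (i + 2) (r + 1)) (Γ i r) ≤ c ∧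
      c < min (Γ (i + 2) r) (shiftRow d (Γ i) r) := by
  have a0 := h r c i hr hc
  have a1 := h r c (i + 1) hr hc
  have a2 := h r c (i + 2) hr hc
  have b1 := hΓ.level_le_min i r
  have b2 := hΓ.max_le_level i r
  have below : (r + 1 = k ∨ T (r + 1) c ≠ i + 1 + 1) ↔
      (c < Γ (i + 1) (r + 1) ∨ Γ (i + 2) (r + 1) ≤ c) := by
    rcases Nat.eq_or_lt_of_le (Nat.succ_le_of_lt hr) with hk | hk
    · have := hΓ.outside (i + 2) (r + 1) hk.ge
      omega
    · have := h (r + 1) c (i + 1) hk hc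
      have := h (r + 1) c (i + 2) hk hc
      omega
  have above : (r = 0 ∨ T (r - 1) c ≠ i + 1) ↔
      (c < shiftRow d (Γ i) r ∨ shiftRow d (Γ (i + 1)) r ≤ c) := by
    cases r with
    | zero => simp [shiftRow, hc]
    | succ r =>
      have := h r c i (by omega) hc
      have := h r c (i + 1) (by omega) hc
      simp only [shiftRow, Nat.add_sub_cancel]
      omega
  have c1 := hΓ.interlace i r
  have c2 : Γ (i + 2) r ≤ shiftRow d (Γ (i + 1)) r := by
    cases r with
    | zero => exact hΓ.le _ _
    | succ r => exact hΓ.interlace _ _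
  unfold bkFree
  rw [below, above]
  omega

lemma Encodes.bk (h : Encodes k d T Γ) (hΓ : IsGTPattern k d n Γ) (i : ℕ) :
    Encodes k d (bk k d (i + 1) T) (gtToggle d i Γ) := by
  classical
  intro r c j hr hc
  have a0 := h r c i hr hc
  have a1 := h r c (i + 1) hr hc
  have a2 := h r c (i + 2) hr hc
  have aj := h r c j hr hc
  have b1 := hΓ.level_le_min i r
  have b2 := hΓ.max_le_level i r
  have hadd := gtToggle_add hΓ i r
  have hle : min (Γ (i + 2) r) (shiftRow d (Γ i) r) ≤ d :=
    (min_le_left _ _).trans (hΓ.le _ _)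
  have hmid1 : Γ i r ≤ max (Γ (i + 2) (r + 1)) (Γ i r) := le_max_right _ _
  have hmid2 : min (Γ (i + 2) r) (shiftRow d (Γ i) r) ≤ Γ (i + 2) r := min_le_left _ _
  have hfree := fun {c} => h.bkFree_iff hΓ i (c := c) hr
  have hne : j ≠ i + 1 → gtToggle d i Γ j = Γ j := gtToggle_of_ne Γ
  generalize max (Γ (i + 2) (r + 1)) (Γ i r) = b at *
  generalize min (Γ (i + 2) r) (shiftRow d (Γ i) r) = a at *
  have hF : ((Finset.range d).filter fun c' => bkFree k (i + 1) T r c') = Finset.Ico b a := by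
    ext c'
    rw [Finset.mem_filter, Finset.mem_range, Finset.mem_Ico]
    constructor
    · rintro ⟨h1, h2⟩
      exact (hfree h1).1 h2
    · intro h1
      exact ⟨by omega, (hfree (by omega)).2 h1⟩
  have hF1 : c < a → ((Finset.Ico b a).filter fun c' => c' < c) = Finset.Ico b c := by
    intro hca
    ext c'
    rw [Finset.mem_filter, Finset.mem_Ico, Finset.mem_Ico]
    omega
  have hF2 : ((Finset.Ico b a).filter fun c' => T r c' = i + 1 + 1) =
      Finset.Ico (Γ (i + 1) r) a := by
    ext c'
    rw [Finset.mem_filter, Finset.mem_Ico, Finset.mem_Ico]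
    constructor
    · rintro ⟨h1, h2⟩
      have := h r c' (i + 1) hr (by omega)
      omega
    · intro h1
      have := h r c' (i + 1) hr (by omega)
      have := h r c' (i + 2) hr (by omega)
      omega
  have hbk : _root_.bk k d (i + 1) T r c =
      if b ≤ c ∧ c < a then (if c - b < a - Γ (i + 1) r then i + 1 else i + 2) else T r c := by
    unfold _root_.bk
    simp only [hF]
    by_cases hca : b ≤ c ∧ c < a
    · rw [if_pos (Finset.mem_Ico.2 hca), if_pos hca]
      have e1 := congrArg Finset.card (hF1 hca.2)
      have e2 := congrArg Finset.card hF2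
      rw [Nat.card_Ico] at e1 e2
      rw [← e1, ← e2]
    · rw [if_neg (by rwa [Finset.mem_Ico]), if_neg hca]
  rw [hbk]
  rcases eq_or_ne j (i + 1) with rfl | hj
  · split_ifs <;> omega
  · rw [hne hj]
    split_ifs <;> omega

/-- The relation between the patterns of a tableau, `B`, and of its promotion, `A`: in each level
below the top, the toggle rule holds with the upper neighbour already updated. -/
def PromotionRel (d n : ℕ) (A B : ℕ → ℕ → ℕ) : Prop :=
  ∀ j r, j + 1 < n → A (j + 1) r + B (j + 1) r =
    min (A (j + 2) r) (shiftRow d (B j) r) + max (A (j + 2) (r + 1)) (B j r)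

lemma Encodes.exists_foldr_bk {m : ℕ} (hm : m + 1 ≤ n) (h : Encodes k d T Γ)
    (hΓ : IsGTPattern k d n Γ) :
    ∃ A, Encodes k d (((List.range m).map (· + 1)).foldr (fun i acc => _root_.bk k d i acc) T) A ∧
      IsGTPattern k d n A ∧ (∀ j > m, A j = Γ j) ∧ PromotionRel d (m + 1) A Γ := by
  induction m generalizing T Γ with
  | zero => exact ⟨Γ, h, hΓ, fun _ _ => rfl, fun j r hj => by omega⟩
  | succ m ih =>
    obtain ⟨A, h1, h2, h3, h4⟩ := ih (by omega) (h.bk hΓ m) (hΓ.gtToggle hm)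
    refine ⟨A, ?_, h2, fun j hj => ?_, fun j r hj => ?_⟩
    · simpa [List.range_succ] using h1
    · rw [h3 j (by omega), gtToggle_of_ne _ (by omega)]
    · rcases Nat.lt_succ_iff_lt_or_eq.1 (Nat.lt_of_succ_lt_succ hj) with hj' | rfl
      · have := h4 j r (by omega)
        rwa [gtToggle_of_ne _ (by omega), gtToggle_of_ne _ (by omega)] at this
      · rw [h3 (j + 1) (by omega), h3 (j + 2) (by omega), gtToggle_add hΓ,
          gtToggle_of_ne _ (by omega)]

lemma Encodes.promo (hn : 0 < n) (h : Encodes k d T Γ) (hΓ : IsGTPattern k d n Γ) :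
    ∃ A, Encodes k d (promo k d n T) A ∧ IsGTPattern k d n A ∧ PromotionRel d n A Γ := by
  obtain ⟨m, rfl⟩ := Nat.exists_eq_add_of_lt hn
  obtain ⟨A, h1, h2, -, h4⟩ := h.exists_foldr_bk (m := m) (by omega) hΓ
  rw [zero_add] at *
  exact ⟨A, h1, h2, h4⟩

lemma IsGTPattern.eq_zero (hΓ : IsGTPattern k d n Γ) {j r : ℕ} (h : j ≤ r) : Γ j r = 0 := by
  induction j generalizing r with
  | zero => exact hΓ.bot r
  | succ j ih =>
    obtain ⟨s, rfl⟩ := Nat.exists_eq_add_of_le' h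
    have := hΓ.interlace j (s + j)
    rw [ih (by omega)] at this
    exact Nat.le_zero.1 this

lemma IsGTPattern.eq_full {L : ℕ} (hΓ : IsGTPattern k d (L + k) Γ) {m r : ℕ} (hm : m ≤ k)
    (h : r < m) : Γ (L + m) r = d := by
  obtain ⟨t, rfl⟩ := Nat.exists_eq_add_of_le hm
  induction t generalizing m r with
  | zero => exact hΓ.top r h
  | succ t ih =>
    have := hΓ.interlace (L + m) r
    rw [show m + (t + 1) = m + 1 + t by omega] at hΓ
    have h1 : Γ (L + m + 1) (r + 1) = d := ih (Nat.succ_lt_succ h) hΓ (by omega)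
    have := hΓ.le (L + m) r
    omega

lemma PromotionRel.sum_eq {A B : ℕ → ℕ → ℕ} (h : PromotionRel d n A B) (hA : IsGTPattern k d n A)
    {j : ℕ} (hj : j + 1 < n) (m : ℕ) :
    ∑ r ∈ Finset.range (m + 1), A (j + 1) r + ∑ r ∈ Finset.range (m + 1), B (j + 1) r =
      max (∑ r ∈ Finset.range (m + 1), A (j + 2) r + ∑ r ∈ Finset.range (m + 1), B j r)
        (∑ r ∈ Finset.range (m + 2), A (j + 2) r + ∑ r ∈ Finset.range m, B j r) := by
  induction m with
  | zero =>
    have h1 : A (j + 1) 0 + B (j + 1) 0 = min (A (j + 2) 0) d + max (A (j + 2) 1) (B j 0) :=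
      h j 0 hj
    have h2 := hA.le (j + 2) 0
    simp [Finset.sum_range_succ]
    omega
  | succ m ih =>
    have h1 : A (j + 1) (m + 1) + B (j + 1) (m + 1) =
        min (A (j + 2) (m + 1)) (B j m) + max (A (j + 2) (m + 2)) (B j (m + 1)) := h j (m + 1) hj
    simp only [Finset.sum_range_succ _ (m + 1), Finset.sum_range_succ _ (m + 2),
      Finset.sum_range_succ _ m] at ih ⊢
    omega

lemma PromotionRel.size_eq {A B : ℕ → ℕ → ℕ} (h : PromotionRel d n A B)
    (hA : IsGTPattern k d n A) (hB : IsGTPattern k d n B) (hk : 0 < k) {j : ℕ} (hj : j < n) :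
    ∑ r ∈ Finset.range k, B j r + A 1 0 = ∑ r ∈ Finset.range k, A (j + 1) r := by
  induction j with
  | zero =>
    rw [Finset.eventually_constant_sum (fun r hr => hA.eq_zero hr) hk]
    simp [hB.bot]
  | succ j ih =>
    have ih := ih (by omega)
    obtain ⟨m, rfl⟩ := Nat.exists_eq_add_of_lt hk
    rw [zero_add] at *
    have h1 := h.sum_eq hA hj m
    have h2 := hA.outside (j + 2) (m + 1) le_rfl
    rw [Finset.sum_range_succ _ (m + 1), h2, Finset.sum_range_succ (fun r => B j r) m] at h1
    rw [Finset.sum_range_succ (fun r => B j r) m] at ih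
    change _ = ∑ r ∈ Finset.range (m + 1), A (j + 2) r
    omega

lemma PromotionRel.tropicalStep {L : ℕ} {A B : ℕ → ℕ → ℕ} (h : PromotionRel d (L + k) A B)
    (hA : IsGTPattern k d (L + k) A) (hB : IsGTPattern k d (L + k) B) (hk : 0 < k) :
    TropicalStep k L d (fun m l => ∑ r ∈ Finset.range m, A (l + m) r)
      (fun m l => ∑ r ∈ Finset.range m, B (l + m) r) where
  zero := by simp
  gap_full := by
    intro m hm
    rw [Finset.sum_congr rfl fun r hr => hB.eq_full hm (Finset.mem_range.1 hr)]
    simp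
  gap_zero := by
    intro m hm
    have := h.size_eq hA hB hk (j := m) (by omega)
    rw [Finset.eventually_constant_sum (fun r hr => hB.eq_zero hr) hm.le,
      Finset.eventually_constant_sum (fun r hr => hA.eq_zero hr) hm] at this
    simpa using this
  full := by
    intro l hl
    have := h.size_eq hA hB hk (j := l + k) (by omega)
    simpa [add_right_comm] using this
  octahedron := by
    intro m l hm hl
    have := h.sum_eq hA (j := l + m + 1) (by omega) m
    convert this using 4 <;> ring_nf

end Patterns

/-- Promotion on rectangular semistandard Young tableaux has order dividing `n`:
applying promotion `n` times to a `k`-row, `d`-column tableau with entries in `{1,…,n}`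
returns the tableau (on every cell of the rectangle). -/
theorem stmt_0 (k d n : ℕ) (T : ℕ → ℕ → ℕ) (hT : IsSSYT k d n T) :
    ∀ r c, r < k → c < d → (promo k d n)^[n] T r c = T r c := by
  intro r c hr hc
  let G : ℕ → ℕ → ℕ → ℕ := fun s => rowCount k d ((promo k d n)^[s] T)
  have hG0 : IsGTPattern k d n (G 0) := hT.isGTPattern_rowCount
  have hkn : k ≤ n := by
    by_contra! h
    have h1 := hG0.top n h
    rw [hG0.eq_zero le_rfl] at h1
    omega
  obtain ⟨L, rfl⟩ := Nat.exists_eq_add_of_le' hkn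
  have hG : ∀ s, Encodes k d ((promo k d (L + k))^[s] T) (G s) ∧ IsGTPattern k d (L + k) (G s) := by
    intro s
    induction s with
    | zero => exact ⟨hT.encodes_rowCount, hG0⟩
    | succ s ih =>
      obtain ⟨A, h1, h2, -⟩ := ih.1.promo (by omega) ih.2
      rw [← Function.iterate_succ_apply' (promo k d (L + k))] at h1
      have := h1.eq_rowCount h2
      subst this
      exact ⟨h1, h2⟩
  have hstep : ∀ s, PromotionRel d (L + k) (G (s + 1)) (G s) := by
    intro s
    obtain ⟨A, h1, h2, h3⟩ := (hG s).1.promo (by omega) (hG s).2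
    rw [← Function.iterate_succ_apply' (promo k d (L + k))] at h1
    have := h1.eq_rowCount h2
    subst this
    exact h3
  have hk : 0 < k := by omega
  have hper : ∀ m ≤ k, ∀ l ≤ L, ∑ r ∈ Finset.range m, G 0 (l + m) r =
      ∑ r ∈ Finset.range m, G (L + k) (l + m) r := by
    intro m hm l hl
    have := TropicalStep.periodic (d := d) (L := L) hk
      (fun i m l => ∑ r ∈ Finset.range m, G (L + k - i) (l + m) r) (by simp)
      (fun m hm => by
        rw [Finset.sum_congr rfl fun r hr => (hG _).2.eq_full hm (Finset.mem_range.1 hr)]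
        simp)
      (fun i hi => by
        obtain ⟨s, hs⟩ := Nat.exists_eq_add_of_lt hi
        have e1 : L + k - i = s + 1 := by omega
        have e2 : L + k - (i + 1) = s := by omega
        simp only [e1, e2]
        exact (hstep s).tropicalStep (hG _).2 (hG _).2 hk) hm hl
    simpa using this
  have hrow : ∀ j ≤ L + k, G (L + k) j r = G 0 j r := by
    intro j hj
    rcases Nat.lt_or_ge r j with hrj | hrj
    · rcases Nat.lt_or_ge (L + r) j with hLj | hLj
      · obtain ⟨m, rfl⟩ := Nat.exists_eq_add_of_le (show L ≤ j by omega)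
        rw [(hG _).2.eq_full (by omega) (by omega), (hG _).2.eq_full (by omega) (by omega)]
      · have h1 := hper r hr.le (j - r) (by omega)
        have h2 := hper (r + 1) hr (j - (r + 1)) (by omega)
        rw [Nat.sub_add_cancel hrj.le] at h1
        rw [Nat.sub_add_cancel hrj, Finset.sum_range_succ, Finset.sum_range_succ] at h2
        omega
    · rw [(hG _).2.eq_zero hrj, (hG _).2.eq_zero hrj]
  have hiff : ∀ j ≤ L + k, ((promo k d (L + k))^[L + k] T r c ≤ j ↔ T r c ≤ j) := by
    intro j hj
    rw [(hG (L + k)).1 r c j hr hc, hrow j hj]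
    exact ((hG 0).1 r c j hr hc).symm
  have hle := (hT.1 r c hr hc).2
  exact le_antisymm ((hiff _ hle).2 le_rfl)
    ((hiff _ ((hiff _ le_rfl).2 hle)).1 le_rfl)
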